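/- arXiv:1506.08155 — 6 statements merged into one kernel-verified Lean document; each statement's English description precedes it below -/
import Mathlib

section
/- Let μ > 0 and let β₁, β₂ ∈ ℝ satisfy β₂ > 0 and 1 + β₂² − 2β₁ > 0. Let (Q∞, S∞) be a bivariate Gaussian vector with Q∞ ~ N(−μ²/2, μ²), S∞ ~ N(β₁μ²/2, β₂²μ²) and Cov(Q∞, S∞) = −β₁μ². Then E[min(1, exp(Q∞ + S∞))] = Φ( −(1 − β₁)μ / (2√(1 + β₂² − 2β₁)) ) + exp( (β₂² − β₁)μ²/2 ) · Φ( −(1 + 2β₂² − 3β₁)μ / (2√(1 + β₂² − 2β₁)) ), where Φ is the standard normal CDF. -/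
open MeasureTheory ProbabilityTheory Real Filter Set
open scoped Topology

/-- The Metropolis–Hastings accept-reject function `F(u) = min(1, eᵘ)`. -/
noncomputable def Facc (u : ℝ) : ℝ := min 1 (Real.exp u)

/-- The law of the limiting bivariate Gaussian pair `(Q∞, S∞)` with
`Q∞ ~ N(−μ²/2, μ²)`, `S∞ ~ N(β₁μ²/2, β₂²μ²)` and `Cov(Q∞, S∞) = −β₁μ²`
(valid whenever `|β₁| ≤ β₂`), realised as the image of two independent
standard Gaussians. -/
noncomputable def QSmeas (μ β₁ β₂ : ℝ) : Measure (ℝ × ℝ) :=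
  Measure.map
    (fun z : ℝ × ℝ =>
      (-μ ^ 2 / 2 + μ * z.1,
        β₁ * μ ^ 2 / 2 + μ * (-(β₁ * z.1) + Real.sqrt (β₂ ^ 2 - β₁ ^ 2) * z.2)))
    ((gaussianReal 0 1).prod (gaussianReal 0 1))

/-- Law of `W_Δ = W* − W ~ N(−σ², 2σ²)` under the Gaussian noise assumption. -/
noncomputable def gaussNoise (σ : ℝ) : Measure ℝ :=
  gaussianReal (-σ ^ 2) (Real.toNNReal (2 * σ ^ 2))

/-- Limiting Stage One acceptance rate `α₁(μ; β₁, β₂) = E[F(Q∞ + S∞)]`. -/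
noncomputable def alpha1 (μ β₁ β₂ : ℝ) : ℝ :=
  ∫ p : ℝ × ℝ, Facc (p.1 + p.2) ∂(QSmeas μ β₁ β₂)

/-- Limiting overall acceptance rate `α₁₂(μ, σ; β₁, β₂) = E[F(Q∞ + S∞)·F(W_Δ − S∞)]`. -/
noncomputable def alpha12 (μ σ β₁ β₂ : ℝ) : ℝ :=
  ∫ p : (ℝ × ℝ) × ℝ, Facc (p.1.1 + p.1.2) * Facc (p.2 - p.1.2)
    ∂((QSmeas μ β₁ β₂).prod (gaussNoise σ))

/-- Standard normal cumulative distribution function `Φ`. -/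
noncomputable def stdPhi (x : ℝ) : ℝ := ((gaussianReal 0 1) (Set.Iic x)).toReal

/-- `ν` is the law of a bivariate Gaussian vector on `ℝ²` with mean `(m₁, m₂)`,
variances `(v₁, v₂)` and covariance `c`, characterised (Cramér–Wold) by the laws of all
linear functionals. -/
def IsBivGaussian (m₁ m₂ v₁ v₂ c : ℝ) (ν : Measure (ℝ × ℝ)) : Prop :=
  ∀ a b : ℝ,
    Measure.map (fun p : ℝ × ℝ => a * p.1 + b * p.2) ν =
      gaussianReal (a * m₁ + b * m₂)
        (Real.toNNReal (a ^ 2 * v₁ + b ^ 2 * v₂ + 2 * a * b * c))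

lemma gaussianReal_real_Iic (m : ℝ) {s : ℝ} (hs : 0 < s) (a : ℝ) :
    (gaussianReal m (s ^ 2).toNNReal).real (Iic a) = stdPhi ((a - m) / s) := by
  have hlaw : gaussianReal m (s ^ 2).toNNReal =
      ((gaussianReal 0 1).map (s * ·)).map (· + m) := by
    rw [gaussianReal_map_const_mul, gaussianReal_map_add_const]
    congr 1
    · simp
    · ext
      simp [sq_nonneg]
  have hpre : (s * ·) ⁻¹' ((· + m) ⁻¹' Iic a) = Iic ((a - m) / s) := by
    ext x
    simp only [mem_preimage, mem_Iic, le_div_iff₀ hs]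
    constructor <;> intro h <;> linarith
  rw [hlaw, measureReal_def, Measure.map_apply (by fun_prop) measurableSet_Iic,
    Measure.map_apply (by fun_prop) (measurableSet_Iic.preimage (by fun_prop)), hpre, stdPhi]

lemma gaussianReal_real_Ioi (m : ℝ) {s : ℝ} (hs : 0 < s) (a : ℝ) :
    (gaussianReal m (s ^ 2).toNNReal).real (Ioi a) = stdPhi ((m - a) / s) := by
  have hv : (s ^ 2).toNNReal ≠ 0 := by simpa using hs.ne'
  have := nullSingletonClass_gaussianReal (μ := m) hv
  have hneg := gaussianReal_real_Iic (-m) hs (-a)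
  rw [← gaussianReal_map_neg, measureReal_def,
    Measure.map_apply measurable_neg measurableSet_Iic] at hneg
  have hpre : (fun x : ℝ ↦ -x) ⁻¹' Iic (-a) = Ici a := by
    ext x
    simp
  rw [hpre] at hneg
  rw [measureReal_def, measure_congr Ioi_ae_eq_Ici, hneg]
  congr 1
  ring

lemma gaussianPDFReal_mul_exp (m x : ℝ) {v : NNReal} (hv : v ≠ 0) :
    gaussianPDFReal m v x * rexp x = rexp (m + v / 2) * gaussianPDFReal (m + v) v x := by
  have hv' : (v : ℝ) ≠ 0 := by exact_mod_cast hv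
  rw [gaussianPDFReal, gaussianPDFReal, mul_assoc, mul_left_comm (rexp _), ← Real.exp_add,
    ← Real.exp_add]
  congr 2
  field_simp
  ring

lemma setIntegral_exp_gaussianReal (m : ℝ) {v : NNReal} (hv : v ≠ 0) {A : Set ℝ}
    (hA : MeasurableSet A) :
    ∫ x in A, rexp x ∂gaussianReal m v =
      rexp (m + v / 2) * (gaussianReal (m + v) v).real A := by
  rw [← integral_indicator hA, integral_gaussianReal_eq_integral_smul hv, measureReal_def,
    gaussianReal_apply_eq_integral _ hv, ENNReal.toReal_ofReal
      (integral_nonneg fun x ↦ gaussianPDFReal_nonneg _ _ x), ← integral_const_mul,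
    ← integral_indicator hA]
  congr 1 with x
  by_cases hx : x ∈ A <;> simp [hx, gaussianPDFReal_mul_exp m x hv]

lemma integral_min_one_exp_gaussianReal (m : ℝ) {s : ℝ} (hs : 0 < s) :
    ∫ x, min 1 (rexp x) ∂gaussianReal m (s ^ 2).toNNReal =
      stdPhi (m / s) + rexp (m + s ^ 2 / 2) * stdPhi (-(m + s ^ 2) / s) := by
  have hv : (s ^ 2).toNNReal ≠ 0 := by simpa using hs.ne'
  have hcoe : ((s ^ 2).toNNReal : ℝ) = s ^ 2 := Real.coe_toNNReal _ (sq_nonneg s)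
  have hint : Integrable (fun x ↦ min 1 (rexp x)) (gaussianReal m (s ^ 2).toNNReal) := by
    refine Integrable.of_bound (by fun_prop) 1 (.of_forall fun x ↦ ?_)
    rw [Real.norm_of_nonneg (by positivity)]
    exact min_le_left _ _
  have hIoi : ∫ x in Ioi 0, min 1 (rexp x) ∂gaussianReal m (s ^ 2).toNNReal = stdPhi (m / s) := by
    rw [setIntegral_congr_fun (g := fun _ ↦ (1 : ℝ)) measurableSet_Ioi fun x hx ↦
      min_eq_left (Real.one_le_exp (mem_Ioi.1 hx).le)]
    simp [gaussianReal_real_Ioi m hs]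
  have hIic : ∫ x in Iic 0, min 1 (rexp x) ∂gaussianReal m (s ^ 2).toNNReal =
      rexp (m + s ^ 2 / 2) * stdPhi (-(m + s ^ 2) / s) := by
    rw [setIntegral_congr_fun (g := rexp) measurableSet_Iic fun x hx ↦
      min_eq_right (Real.exp_le_one_iff.2 hx), setIntegral_exp_gaussianReal m hv measurableSet_Iic,
      gaussianReal_real_Iic _ hs, hcoe, zero_sub]
  rw [← integral_add_compl measurableSet_Ioi hint, compl_Ioi, hIoi, hIic]

/-- closed form for the limiting Stage One acceptance rate
`E[min(1, exp(Q∞ + S∞))]` where `(Q∞, S∞)` is bivariate Gaussian with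
`Q∞ ~ N(−μ²/2, μ²)`, `S∞ ~ N(β₁μ²/2, β₂²μ²)`, `Cov(Q∞, S∞) = −β₁μ²`. -/
theorem stmt4 (μ β₁ β₂ : ℝ) (hμ : 0 < μ) (hβ₂ : 0 < β₂)
    (hpos : 0 < 1 + β₂ ^ 2 - 2 * β₁)
    (ν : Measure (ℝ × ℝ)) (hprob : IsProbabilityMeasure ν)
    (hν : IsBivGaussian (-μ ^ 2 / 2) (β₁ * μ ^ 2 / 2) (μ ^ 2) (β₂ ^ 2 * μ ^ 2)
      (-(β₁ * μ ^ 2)) ν) :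
    ∫ p : ℝ × ℝ, min 1 (Real.exp (p.1 + p.2)) ∂ν =
      stdPhi (-(1 - β₁) * μ / (2 * Real.sqrt (1 + β₂ ^ 2 - 2 * β₁))) +
        Real.exp ((β₂ ^ 2 - β₁) * μ ^ 2 / 2) *
          stdPhi (-(1 + 2 * β₂ ^ 2 - 3 * β₁) * μ / (2 * Real.sqrt (1 + β₂ ^ 2 - 2 * β₁))) := by
  set D := 1 + β₂ ^ 2 - 2 * β₁ with hD
  have hsqrt : 0 < √D := Real.sqrt_pos.2 hpos
  have hsq : √D ^ 2 = D := Real.sq_sqrt hpos.le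
  have hlaw : ν.map (fun p : ℝ × ℝ ↦ p.1 + p.2) =
      gaussianReal (-(1 - β₁) * μ ^ 2 / 2) ((√D * μ) ^ 2).toNNReal := by
    have h := hν 1 1
    simp only [one_mul] at h
    rw [h, mul_pow, hsq, hD]
    congr 2 <;> ring
  rw [← integral_map (φ := fun p : ℝ × ℝ ↦ p.1 + p.2) (f := fun x ↦ min 1 (rexp x))
    (by fun_prop) (by fun_prop), hlaw, integral_min_one_exp_gaussianReal _ (by positivity),
    mul_pow, hsq]
  have hfst : -(1 - β₁) * μ ^ 2 / 2 / (√D * μ) = -(1 - β₁) * μ / (2 * √D) := by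
    field_simp
  have hexp : -(1 - β₁) * μ ^ 2 / 2 + D * μ ^ 2 / 2 = (β₂ ^ 2 - β₁) * μ ^ 2 / 2 := by
    rw [hD]
    ring
  have hsnd : -(-(1 - β₁) * μ ^ 2 / 2 + D * μ ^ 2) / (√D * μ) =
      -(1 + 2 * β₂ ^ 2 - 3 * β₁) * μ / (2 * √D) := by
    rw [div_eq_div_iff (by positivity) (by positivity)]
    linear_combination (-2 * μ ^ 2 * √D) * hD
  rw [hfst, hexp, hsnd]
end

section
/- Let β₂ > 0 and β₁ < 1 with |β₁| ≤ β₂. Then the map μ ↦ α₁(μ; β₁, β₂) := G( −(1 − β₁)μ²/2, (1 + β₂² − 2β₁)μ² ) is a continuous strictly decreasing bijection from [0, ∞) onto (0, 1]. -/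
open MeasureTheory ProbabilityTheory Real Filter Set
open scoped Topology

/-- `G(m, v) = E[min(1, e^N)]` for `N ~ N(m, v)`; for `v > 0` this is
`Φ(m/√v) + e^{m + v/2} Φ(−√v − m/√v)`, and `G(m, 0) = min(1, e^m)`. -/
noncomputable def Gfun (m v : ℝ) : ℝ :=
  if v = 0 then min 1 (Real.exp m)
  else stdPhi (m / Real.sqrt v) + Real.exp (m + v / 2) * stdPhi (-Real.sqrt v - m / Real.sqrt v)

lemma gaussianPDFReal_zero_one (x : ℝ) :
    gaussianPDFReal 0 1 x = (√(2 * π))⁻¹ * rexp (-x ^ 2 / 2) := by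
  simp [gaussianPDFReal]

lemma stdPhi_eq_integral (x : ℝ) : stdPhi x = ∫ t in Iic x, gaussianPDFReal 0 1 t := by
  rw [stdPhi, gaussianReal_apply_eq_integral 0 one_ne_zero, ENNReal.toReal_ofReal]
  exact integral_nonneg fun t => gaussianPDFReal_nonneg 0 1 t

lemma stdPhi_eq_cdf : stdPhi = cdf (gaussianReal 0 1) := by
  ext x
  rw [cdf_eq_real, stdPhi, measureReal_def]

lemma stdPhi_nonneg (x : ℝ) : 0 ≤ stdPhi x := ENNReal.toReal_nonneg

lemma stdPhi_le_one (x : ℝ) : stdPhi x ≤ 1 := by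
  rw [stdPhi_eq_cdf]
  exact cdf_le_one _ x

lemma tendsto_stdPhi_atBot : Tendsto stdPhi atBot (𝓝 0) := by
  rw [stdPhi_eq_cdf]
  exact tendsto_cdf_atBot _

lemma stdPhi_zero : stdPhi 0 = 1 / 2 := by
  have hr : (gaussianReal 0 1).real (Ici 0) = (gaussianReal 0 1).real (Iic 0) := by
    have h := gaussianReal_map_neg (μ := 0) (v := 1)
    rw [neg_zero] at h
    conv_rhs => rw [← h]
    rw [map_measureReal_apply measurable_neg measurableSet_Iic]
    congr 1
    ext x
    simp
  have : NullSingletonClass (gaussianReal 0 1) := nullSingletonClass_gaussianReal one_ne_zero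
  have hI : (gaussianReal 0 1).real (Ioi 0) = (gaussianReal 0 1).real (Ici 0) :=
    measureReal_congr Ioi_ae_eq_Ici
  have hc := probReal_compl_eq_one_sub (μ := gaussianReal 0 1) (measurableSet_Iic (a := (0 : ℝ)))
  rw [compl_Iic, hI, hr] at hc
  have : stdPhi 0 = (gaussianReal 0 1).real (Iic 0) := rfl
  linarith

lemma hasDerivAt_stdPhi (x : ℝ) : HasDerivAt stdPhi (gaussianPDFReal 0 1 x) x := by
  have hint := integrable_gaussianPDFReal 0 1
  have hcont : Continuous (gaussianPDFReal 0 1) := by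
    unfold gaussianPDFReal
    fun_prop
  have heq : stdPhi = fun y => stdPhi 0 + ∫ t in (0 : ℝ)..y, gaussianPDFReal 0 1 t := by
    ext y
    rw [← intervalIntegral.integral_Iic_sub_Iic hint.integrableOn hint.integrableOn,
      ← stdPhi_eq_integral, ← stdPhi_eq_integral]
    ring
  rw [heq]
  exact (intervalIntegral.integral_hasDerivAt_right hint.intervalIntegrable
    hcont.stronglyMeasurable.stronglyMeasurableAtFilter hcont.continuousAt).const_add _

/-- The Mills ratio bound for the Gaussian tail. -/
lemma mul_stdPhi_neg_le (x : ℝ) : x * stdPhi (-x) ≤ gaussianPDFReal 0 1 x := by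
  have hint := integrable_gaussianPDFReal 0 1
  have hderiv (t : ℝ) :
      HasDerivAt (gaussianPDFReal 0 1) (-t * gaussianPDFReal 0 1 t) t := by
    have h : HasDerivAt (fun y : ℝ => (√(2 * π))⁻¹ * rexp (-y ^ 2 / 2))
        ((√(2 * π))⁻¹ * (rexp (-t ^ 2 / 2) * (-(2 * t) / 2))) t := by
      have := ((hasDerivAt_pow 2 t).neg.div_const 2).exp.const_mul (√(2 * π))⁻¹
      simpa using this
    rw [funext gaussianPDFReal_zero_one]
    convert h using 1
    ring
  have hint' : Integrable fun t => -t * gaussianPDFReal 0 1 t := by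
    have h := (integrable_mul_exp_neg_mul_sq (b := 1 / 2) (by norm_num)).const_mul
      (-(√(2 * π))⁻¹)
    refine h.congr (ae_of_all _ fun t => ?_)
    simp only [gaussianPDFReal_zero_one]
    ring_nf
  have htend : Tendsto (gaussianPDFReal 0 1) atBot (𝓝 0) :=
    tendsto_zero_of_hasDerivAt_of_integrableOn_Iic (a := 0) (fun t _ => hderiv t)
      hint'.integrableOn hint.integrableOn
  have hI := integral_Iic_of_hasDerivAt_of_tendsto' (a := -x) (fun t _ => hderiv t)
    hint'.integrableOn htend
  have hsymm : gaussianPDFReal 0 1 (-x) = gaussianPDFReal 0 1 x := by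
    simp [gaussianPDFReal_zero_one]
  rw [hsymm, sub_zero] at hI
  rw [stdPhi_eq_integral, ← integral_const_mul, ← hI]
  refine setIntegral_mono_on (hint.const_mul x).integrableOn hint'.integrableOn
    measurableSet_Iic fun t ht => ?_
  have ht' : t ≤ -x := ht
  exact mul_le_mul_of_nonneg_right (by linarith) (gaussianPDFReal_nonneg 0 1 t)

/-- `E[min(1, e^N)]` for Gaussian `N` with standard deviation `(a + b) x` and mean
`-a (a + b) x²`. -/
noncomputable def gaussAccept (a b x : ℝ) : ℝ :=
  stdPhi (-(a * x)) + rexp ((b ^ 2 - a ^ 2) * x ^ 2 / 2) * stdPhi (-(b * x))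

lemma gaussAccept_zero (a b : ℝ) : gaussAccept a b 0 = 1 := by
  simp [gaussAccept, stdPhi_zero]
  norm_num

lemma gaussAccept_nonneg (a b x : ℝ) : 0 ≤ gaussAccept a b x :=
  add_nonneg (stdPhi_nonneg _) (mul_nonneg (exp_pos _).le (stdPhi_nonneg _))

lemma exp_mul_gaussianPDFReal (a b x : ℝ) :
    rexp ((b ^ 2 - a ^ 2) * x ^ 2 / 2) * gaussianPDFReal 0 1 (b * x) =
      gaussianPDFReal 0 1 (a * x) := by
  rw [gaussianPDFReal_zero_one, gaussianPDFReal_zero_one, mul_left_comm, ← Real.exp_add]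
  ring_nf

lemma hasDerivAt_gaussAccept (a b x : ℝ) :
    HasDerivAt (gaussAccept a b)
      ((a + b) * rexp ((b ^ 2 - a ^ 2) * x ^ 2 / 2) *
        ((b - a) * x * stdPhi (-(b * x)) - gaussianPDFReal 0 1 (b * x))) x := by
  have hphi (c : ℝ) : HasDerivAt (fun y => stdPhi (-(c * y)))
      (gaussianPDFReal 0 1 (c * x) * -c) x := by
    have hl : HasDerivAt (fun y : ℝ => -(c * y)) (-c) x := by
      simpa using (hasDerivAt_id x).const_mul (-c)
    have hsymm : gaussianPDFReal 0 1 (-(c * x)) = gaussianPDFReal 0 1 (c * x) := by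
      simp [gaussianPDFReal_zero_one]
    rw [← hsymm]
    exact (hasDerivAt_stdPhi (-(c * x))).comp x hl
  have hexp : HasDerivAt (fun y : ℝ => rexp ((b ^ 2 - a ^ 2) * y ^ 2 / 2))
      (rexp ((b ^ 2 - a ^ 2) * x ^ 2 / 2) * ((b ^ 2 - a ^ 2) * (2 * x) / 2)) x := by
    simpa using (((hasDerivAt_pow 2 x).const_mul (b ^ 2 - a ^ 2)).div_const 2).exp
  refine ((hphi a).add (hexp.mul (hphi b))).congr_deriv ?_
  rw [← exp_mul_gaussianPDFReal a b x]
  ring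

lemma continuous_gaussAccept (a b : ℝ) : Continuous (gaussAccept a b) :=
  continuous_iff_continuousAt.2 fun x => (hasDerivAt_gaussAccept a b x).continuousAt

lemma strictAntiOn_gaussAccept {a b : ℝ} (ha : 0 < a) (hab : 0 < a + b) :
    StrictAntiOn (gaussAccept a b) (Ici 0) := by
  refine strictAntiOn_of_deriv_neg (convex_Ici 0) (continuous_gaussAccept a b).continuousOn
    fun x hx => ?_
  rw [interior_Ici] at hx
  have hx' : 0 < x := hx
  rw [(hasDerivAt_gaussAccept a b x).deriv]
  refine mul_neg_of_pos_of_neg (mul_pos hab (exp_pos _)) ?_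
  have hpos := gaussianPDFReal_pos 0 1 (b * x) one_ne_zero
  have hmills := mul_stdPhi_neg_le (b * x)
  have hphi := mul_nonneg hx'.le (stdPhi_nonneg (-(b * x)))
  rcases le_or_gt b a with hba | hba
  · nlinarith [mul_nonneg (sub_nonneg.2 hba) hphi]
  · have hb : 0 < b := ha.trans hba
    refine sub_neg.2 (lt_of_mul_lt_mul_left ?_ hb.le)
    calc b * ((b - a) * x * stdPhi (-(b * x)))
        = (b - a) * (b * x * stdPhi (-(b * x))) := by ring
      _ ≤ (b - a) * gaussianPDFReal 0 1 (b * x) :=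
        mul_le_mul_of_nonneg_left hmills (sub_pos.2 hba).le
      _ < b * gaussianPDFReal 0 1 (b * x) := mul_lt_mul_of_pos_right (by linarith) hpos

lemma tendsto_gaussAccept_atTop {a b : ℝ} (ha : 0 < a) (hab : 0 < a + b) :
    Tendsto (gaussAccept a b) atTop (𝓝 0) := by
  have hphi {c : ℝ} (hc : 0 < c) : Tendsto (fun x => stdPhi (-(c * x))) atTop (𝓝 0) :=
    tendsto_stdPhi_atBot.comp
      (tendsto_neg_atTop_atBot.comp (tendsto_id.const_mul_atTop hc))
  have hexp {c : ℝ} (hc : c < 0) :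
      Tendsto (fun x : ℝ => rexp (c * x ^ 2 / 2)) atTop (𝓝 0) := by
    refine tendsto_exp_atBot.comp ?_
    have := (tendsto_pow_atTop (α := ℝ) two_ne_zero).const_mul_atTop_of_neg
      (show c / 2 < 0 by linarith)
    exact this.congr fun x => by ring
  suffices h : Tendsto
      (fun x => rexp ((b ^ 2 - a ^ 2) * x ^ 2 / 2) * stdPhi (-(b * x))) atTop (𝓝 0) by
    simpa [funext (gaussAccept.eq_1 a b)] using (hphi ha).add h
  have hnn (x : ℝ) : 0 ≤ rexp ((b ^ 2 - a ^ 2) * x ^ 2 / 2) * stdPhi (-(b * x)) :=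
    mul_nonneg (exp_pos _).le (stdPhi_nonneg _)
  rcases lt_or_ge b a with hba | hba
  · refine squeeze_zero hnn (fun x => mul_le_of_le_one_right (exp_pos _).le (stdPhi_le_one _))
      (hexp ?_)
    nlinarith
  · have hb : 0 < b := ha.trans_le hba
    have hg : Tendsto (fun x => gaussianPDFReal 0 1 (a * x)) atTop (𝓝 0) := by
      have := (hexp (c := -a ^ 2) (by nlinarith)).const_mul (√(2 * π))⁻¹
      rw [mul_zero] at this
      refine this.congr fun x => ?_
      rw [gaussianPDFReal_zero_one]
      ring_nf
    have hg' := hg.const_mul b⁻¹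
    rw [mul_zero] at hg'
    refine squeeze_zero' (Eventually.of_forall hnn) ?_ hg'
    filter_upwards [eventually_ge_atTop 1] with x hx
    rw [← exp_mul_gaussianPDFReal a b x, mul_left_comm]
    refine mul_le_mul_of_nonneg_left ?_ (exp_pos _).le
    rw [inv_mul_eq_div, le_div_iff₀ hb]
    have hmills := mul_stdPhi_neg_le (b * x)
    have := mul_nonneg (mul_nonneg hb.le (sub_nonneg.2 hx)) (stdPhi_nonneg (-(b * x)))
    nlinarith

lemma bijOn_gaussAccept {a b : ℝ} (ha : 0 < a) (hab : 0 < a + b) :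
    BijOn (gaussAccept a b) (Ici 0) (Ioc 0 1) := by
  have hanti := strictAntiOn_gaussAccept ha hab
  refine ⟨fun x hx => ⟨?_, ?_⟩, hanti.injOn, fun y hy => ?_⟩
  · have hx' : (0 : ℝ) ≤ x := hx
    exact (gaussAccept_nonneg a b (x + 1)).trans_lt
      (hanti hx (mem_Ici.2 (by linarith)) (by linarith))
  · rw [← gaussAccept_zero a b]
    exact hanti.antitoneOn self_mem_Ici hx hx
  · obtain ⟨M, hM, hM0⟩ := (((tendsto_gaussAccept_atTop ha hab).eventually
      (gt_mem_nhds hy.1)).and (eventually_ge_atTop 0)).exists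
    obtain ⟨x, hx, hxy⟩ := intermediate_value_Icc' hM0
      (continuous_gaussAccept a b).continuousOn
      (show y ∈ Icc (gaussAccept a b M) (gaussAccept a b 0) from
        ⟨hM.le, by rw [gaussAccept_zero]; exact hy.2⟩)
    exact ⟨x, hx.1, hxy⟩

lemma Gfun_eq_gaussAccept {a b x : ℝ} (hab : 0 < a + b) (hx : 0 ≤ x) :
    Gfun (-(a * (a + b)) * x ^ 2) ((a + b) ^ 2 * x ^ 2) = gaussAccept a b x := by
  rcases hx.eq_or_lt with rfl | hx
  · simp [Gfun, gaussAccept_zero]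
  have hs : √((a + b) ^ 2 * x ^ 2) = (a + b) * x := by
    rw [← mul_pow, Real.sqrt_sq (mul_pos hab hx).le]
  have hm : -(a * (a + b)) * x ^ 2 / ((a + b) * x) = -(a * x) := by
    field_simp
  rw [Gfun, if_neg (by positivity), hs, hm, gaussAccept]
  congr 3 <;> ring

/-- for `β₂ > 0` and `β₁ < 1` with `|β₁| ≤ β₂`, the map
`μ ↦ α₁(μ; β₁, β₂) = G(−(1−β₁)μ²/2, (1+β₂²−2β₁)μ²)` is a continuous strictly decreasing
bijection from `[0, ∞)` onto `(0, 1]`. -/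
theorem stmt5 (β₁ β₂ : ℝ) (hβ₂ : 0 < β₂) (hβ₁ : β₁ < 1) (hβ : |β₁| ≤ β₂) :
    ContinuousOn
        (fun μ : ℝ => Gfun (-(1 - β₁) * μ ^ 2 / 2) ((1 + β₂ ^ 2 - 2 * β₁) * μ ^ 2))
        (Set.Ici 0) ∧
      StrictAntiOn
        (fun μ : ℝ => Gfun (-(1 - β₁) * μ ^ 2 / 2) ((1 + β₂ ^ 2 - 2 * β₁) * μ ^ 2))
        (Set.Ici 0) ∧
      Set.BijOn
        (fun μ : ℝ => Gfun (-(1 - β₁) * μ ^ 2 / 2) ((1 + β₂ ^ 2 - 2 * β₁) * μ ^ 2))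
        (Set.Ici 0) (Set.Ioc 0 1) := by
  set κ := 1 + β₂ ^ 2 - 2 * β₁ with hκ
  have hsq : β₁ ^ 2 ≤ β₂ ^ 2 := sq_le_sq' (by linarith [neg_abs_le β₁]) ((le_abs_self β₁).trans hβ)
  have hκ0 : 0 < κ := by nlinarith [pow_pos (sub_pos.2 hβ₁) 2]
  set k := √κ
  have hk : 0 < k := Real.sqrt_pos.2 hκ0
  have hk2 : k ^ 2 = κ := Real.sq_sqrt hκ0.le
  set a := (1 - β₁) / (2 * k) with ha_def
  have ha : 0 < a := div_pos (by linarith) (by linarith)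
  have hab : a + (k - a) = k := by ring
  have hab0 : 0 < a + (k - a) := by rwa [hab]
  have hak : a * k = (1 - β₁) / 2 := by
    rw [ha_def]
    field_simp
  have heq : EqOn (gaussAccept a (k - a))
      (fun μ : ℝ => Gfun (-(1 - β₁) * μ ^ 2 / 2) (κ * μ ^ 2)) (Ici 0) := by
    intro x hx
    rw [← Gfun_eq_gaussAccept hab0 hx, hab, hk2, hak]
    congr 1
    ring
  exact ⟨(continuous_gaussAccept a (k - a)).continuousOn.congr heq.symm,
    (strictAntiOn_gaussAccept ha hab0).congr heq, (bijOn_gaussAccept ha hab0).congr heq⟩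
end

section
/- Fix μ > 0, β₂ > 0 and β₁ ∈ ℝ with |β₁| ≤ β₂. Then the map σ ↦ α_{2|1}(μ, σ) := α₁₂(μ, σ)/α₁(μ) is a strictly decreasing bijection from [0, ∞) onto (0, α_{2|1}(μ, 0)], where at σ = 0 one sets W_Δ := 0, i.e. α₁₂(μ, 0) := E[F(Q∞ + S∞)·F(−S∞)]. -/
open MeasureTheory ProbabilityTheory Real Filter Set
open scoped Topology

lemma continuous_Facc : Continuous Facc :=
  continuous_const.min Real.continuous_exp

lemma Facc_pos (u : ℝ) : 0 < Facc u := lt_min one_pos (Real.exp_pos u)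

lemma Facc_le_one (u : ℝ) : Facc u ≤ 1 := min_le_left _ _

lemma Facc_le_exp (u : ℝ) : Facc u ≤ Real.exp u := min_le_right _ _

lemma norm_Facc_le_one (u : ℝ) : ‖Facc u‖ ≤ 1 := by
  rw [Real.norm_eq_abs, abs_of_pos (Facc_pos u)]
  exact Facc_le_one u

lemma tendsto_Facc_atBot : Tendsto Facc atBot (𝓝 0) :=
  squeeze_zero (fun u => (Facc_pos u).le) Facc_le_exp Real.tendsto_exp_atBot

lemma integrable_Facc_comp {α : Type*} [TopologicalSpace α] [MeasurableSpace α]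
    [OpensMeasurableSpace α] (ν : Measure α) [IsFiniteMeasure ν] {f : α → ℝ}
    (hf : Continuous f) : Integrable (fun x => Facc (f x)) ν :=
  .of_bound (continuous_Facc.measurable.comp hf.measurable).aestronglyMeasurable 1
    (.of_forall fun x => norm_Facc_le_one (f x))

lemma integral_lt_integral_of_forall_lt {α : Type*} [MeasurableSpace α] {ν : Measure α} [NeZero ν]
    {f g : α → ℝ} (hf : Integrable f ν) (hg : Integrable g ν) (h : ∀ x, f x < g x) :
    ∫ x, f x ∂ν < ∫ x, g x ∂ν := by
  rw [← sub_pos, ← integral_sub hg hf,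
    integral_pos_iff_support_of_nonneg (fun x => (sub_pos.2 (h x)).le) (hg.sub hf)]
  have : Function.support (fun x => g x - f x) = univ :=
    eq_univ_of_forall fun x => (sub_pos.2 (h x)).ne'
  rw [this]
  exact Measure.measure_univ_pos.2 (NeZero.ne ν)

instance isProbabilityMeasure_gaussNoise (σ : ℝ) : IsProbabilityMeasure (gaussNoise σ) := by
  unfold gaussNoise
  infer_instance

instance isProbabilityMeasure_QSmeas (μ β₁ β₂ : ℝ) : IsProbabilityMeasure (QSmeas μ β₁ β₂) :=
  Measure.isProbabilityMeasure_map (by fun_prop)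

lemma isOpenPosMeasure_gaussNoise {σ : ℝ} (hσ : 0 < σ) : (gaussNoise σ).IsOpenPosMeasure := by
  refine (gaussianReal_absolutelyContinuous' _ ?_).isOpenPosMeasure
  exact (Real.toNNReal_pos.2 (by positivity)).ne'

lemma gaussNoise_eq_map (σ : ℝ) :
    gaussNoise σ = (gaussianReal 0 1).map (fun z => -σ ^ 2 + √2 * σ * z) := by
  have h : (fun z : ℝ => -σ ^ 2 + √2 * σ * z) =
      (fun y => -σ ^ 2 + y) ∘ (fun z => √2 * σ * z) := rfl
  rw [h, ← Measure.map_map (by fun_prop) (by fun_prop), gaussianReal_map_const_mul,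
    gaussianReal_map_const_add, gaussNoise]
  congr 1
  · simp
  · ext
    simp [mul_pow, sq_nonneg]

lemma gaussNoise_conv {σ τ ρ : ℝ} (h : ρ ^ 2 = σ ^ 2 + τ ^ 2) :
    (gaussNoise σ).conv (gaussNoise τ) = gaussNoise ρ := by
  rw [gaussNoise, gaussNoise, gaussianReal_conv_gaussianReal, gaussNoise, h,
    ← Real.toNNReal_add (by positivity) (by positivity)]
  congr 1
  · ring
  · ring_nf

lemma integrable_exp_gaussNoise (σ : ℝ) : Integrable Real.exp (gaussNoise σ) := by
  simpa [gaussNoise] using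
    integrable_exp_mul_gaussianReal (μ := -σ ^ 2) (v := Real.toNNReal (2 * σ ^ 2)) 1

lemma integral_exp_gaussNoise (σ : ℝ) : ∫ w, Real.exp w ∂(gaussNoise σ) = 1 := by
  have h := congrFun (mgf_fun_id_gaussianReal (μ := -σ ^ 2) (v := Real.toNNReal (2 * σ ^ 2))) 1
  simp only [mgf, one_mul, mul_one] at h
  rw [gaussNoise, h, Real.coe_toNNReal _ (by positivity)]
  norm_num

/-- Strict form of Jensen's inequality for `Facc` under a mean-one log-normal factor. -/
lemma integral_Facc_add_lt {τ : ℝ} (hτ : 0 < τ) (u : ℝ) :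
    ∫ y, Facc (u + y) ∂(gaussNoise τ) < Facc u := by
  have := isOpenPosMeasure_gaussNoise hτ
  have hF : Integrable (fun y => Facc (u + y)) (gaussNoise τ) :=
    integrable_Facc_comp _ (by fun_prop)
  have hFc : Continuous (fun y => Facc (u + y)) := continuous_Facc.comp (by fun_prop)
  refine lt_min ?_ ?_
  · have h : 0 < ∫ y, (1 - Facc (u + y)) ∂(gaussNoise τ) := by
      refine integral_pos_of_integrable_nonneg_nonzero (x := -u - 1) (by fun_prop)
        ((integrable_const 1).sub hF) (fun y => sub_nonneg.2 (Facc_le_one _)) (sub_pos.2 ?_).ne'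
      refine (Facc_le_exp _).trans_lt (Real.exp_lt_one_iff.2 ?_)
      linarith
    rw [integral_sub (integrable_const 1) hF] at h
    simpa using h
  · have he := (integrable_exp_gaussNoise τ).const_mul (Real.exp u)
    have h : 0 < ∫ y, (Real.exp u * Real.exp y - Facc (u + y)) ∂(gaussNoise τ) := by
      refine integral_pos_of_integrable_nonneg_nonzero (x := -u + 1) (by fun_prop)
        (he.sub hF) (fun y => ?_) (sub_pos.2 ?_).ne'
      · simpa [← Real.exp_add] using Facc_le_exp (u + y)
      · rw [← Real.exp_add]
        refine (Facc_le_one _).trans_lt (Real.one_lt_exp_iff.2 ?_)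
        linarith
    rw [integral_sub he hF, integral_const_mul, integral_exp_gaussNoise] at h
    linarith

/-- The conditional Stage Two acceptance rate `E[F(W_Δ − s)]`. -/
noncomputable def stageTwoRate (σ s : ℝ) : ℝ := ∫ w, Facc (w - s) ∂(gaussNoise σ)

lemma stageTwoRate_eq (σ s : ℝ) :
    stageTwoRate σ s = ∫ z, Facc (-σ ^ 2 + √2 * σ * z - s) ∂(gaussianReal 0 1) := by
  rw [stageTwoRate, gaussNoise_eq_map, integral_map (by fun_prop)]
  exact (continuous_Facc.comp (by fun_prop)).aestronglyMeasurable

lemma continuous_stageTwoRate : Continuous (fun p : ℝ × ℝ => stageTwoRate p.1 p.2) := by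
  simp_rw [stageTwoRate_eq]
  refine continuous_of_dominated (bound := fun _ => 1) (fun p => ?_)
    (fun p => .of_forall fun z => norm_Facc_le_one _) (integrable_const 1)
    (.of_forall fun z => continuous_Facc.comp (by fun_prop))
  exact (continuous_Facc.comp (by fun_prop)).aestronglyMeasurable

lemma stageTwoRate_pos (σ s : ℝ) : 0 < stageTwoRate σ s := by
  simpa [stageTwoRate] using integral_lt_integral_of_forall_lt (integrable_const 0)
    (integrable_Facc_comp (gaussNoise σ) (f := fun w => w - s) (by fun_prop))
    (fun w => Facc_pos _)

lemma stageTwoRate_le_one (σ s : ℝ) : stageTwoRate σ s ≤ 1 := by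
  simpa [stageTwoRate] using integral_mono
    (integrable_Facc_comp (gaussNoise σ) (f := fun w => w - s) (by fun_prop))
    (integrable_const 1) (fun w => Facc_le_one _)

lemma tendsto_stageTwoRate (s : ℝ) : Tendsto (fun σ => stageTwoRate σ s) atTop (𝓝 0) := by
  simp_rw [stageTwoRate_eq]
  suffices h : Tendsto (fun σ => ∫ z, Facc (-σ ^ 2 + √2 * σ * z - s) ∂(gaussianReal 0 1)) atTop
      (𝓝 (∫ _, 0 ∂(gaussianReal 0 1))) by simpa using h
  refine tendsto_integral_filter_of_dominated_convergence (fun _ => 1)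
    (.of_forall fun σ => (continuous_Facc.comp (by fun_prop)).aestronglyMeasurable)
    (.of_forall fun σ => .of_forall fun z => norm_Facc_le_one _) (integrable_const 1)
    (.of_forall fun z => tendsto_Facc_atBot.comp ?_)
  have h : Tendsto (fun σ : ℝ => σ * (-σ + √2 * z)) atTop atBot :=
    tendsto_id.atTop_mul_atBot₀ (tendsto_atBot_add_const_right _ _ tendsto_neg_atTop_atBot)
  refine (tendsto_atBot_add_const_right _ (-s) h).congr fun σ => ?_
  ring

lemma strictAntiOn_stageTwoRate (s : ℝ) : StrictAntiOn (fun σ => stageTwoRate σ s) (Ici 0) := by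
  intro σ hσ ρ _ hlt
  have hσ0 : 0 ≤ σ := hσ
  have hsq : 0 < ρ ^ 2 - σ ^ 2 := by nlinarith
  have hconv := gaussNoise_conv (σ := σ) (τ := √(ρ ^ 2 - σ ^ 2)) (ρ := ρ)
    (by rw [Real.sq_sqrt hsq.le]; ring)
  have hint : Integrable (fun w => Facc (w - s))
      ((gaussNoise σ).conv (gaussNoise √(ρ ^ 2 - σ ^ 2))) := by
    rw [hconv]
    exact integrable_Facc_comp _ (by fun_prop)
  have hprod := integrable_Facc_comp ((gaussNoise σ).prod (gaussNoise √(ρ ^ 2 - σ ^ 2)))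
    (f := fun p : ℝ × ℝ => p.1 + p.2 - s) (by fun_prop)
  change stageTwoRate ρ s < stageTwoRate σ s
  rw [stageTwoRate, ← hconv, integral_conv hint, stageTwoRate]
  refine integral_lt_integral_of_forall_lt hprod.integral_prod_left
    (integrable_Facc_comp _ (by fun_prop)) fun x => ?_
  simpa only [add_sub_right_comm] using integral_Facc_add_lt (Real.sqrt_pos.2 hsq) (x - s)

lemma alpha12_eq (μ σ β₁ β₂ : ℝ) :
    alpha12 μ σ β₁ β₂ =
      ∫ p : ℝ × ℝ, Facc (p.1 + p.2) * stageTwoRate σ p.2 ∂(QSmeas μ β₁ β₂) := by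
  have hint : Integrable
      (fun p : (ℝ × ℝ) × ℝ => Facc (p.1.1 + p.1.2) * Facc (p.2 - p.1.2))
      ((QSmeas μ β₁ β₂).prod (gaussNoise σ)) :=
    (integrable_Facc_comp _ (f := fun p : (ℝ × ℝ) × ℝ => p.2 - p.1.2) (by fun_prop)).bdd_mul
      (c := 1)
      (continuous_Facc.comp (by fun_prop)).aestronglyMeasurable
      (.of_forall fun p => norm_Facc_le_one _)
  rw [alpha12, integral_prod _ hint]
  simp_rw [integral_const_mul, stageTwoRate]

lemma continuous_Facc_mul_stageTwoRate (σ : ℝ) :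
    Continuous (fun p : ℝ × ℝ => Facc (p.1 + p.2) * stageTwoRate σ p.2) :=
  (continuous_Facc.comp (by fun_prop)).mul
    (continuous_stageTwoRate.comp (continuous_const.prodMk continuous_snd))

lemma norm_Facc_mul_stageTwoRate_le (σ u s : ℝ) : ‖Facc u * stageTwoRate σ s‖ ≤ 1 := by
  rw [norm_mul, Real.norm_of_nonneg (stageTwoRate_pos σ s).le]
  exact mul_le_one₀ (norm_Facc_le_one u) (stageTwoRate_pos σ s).le (stageTwoRate_le_one σ s)

lemma integrable_Facc_mul_stageTwoRate (σ μ β₁ β₂ : ℝ) :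
    Integrable (fun p : ℝ × ℝ => Facc (p.1 + p.2) * stageTwoRate σ p.2) (QSmeas μ β₁ β₂) :=
  .of_bound (continuous_Facc_mul_stageTwoRate σ).aestronglyMeasurable 1
    (.of_forall fun p => norm_Facc_mul_stageTwoRate_le _ _ _)

lemma alpha1_pos (μ β₁ β₂ : ℝ) : 0 < alpha1 μ β₁ β₂ := by
  simpa [alpha1] using integral_lt_integral_of_forall_lt (integrable_const 0)
    (integrable_Facc_comp (QSmeas μ β₁ β₂) (f := fun p => p.1 + p.2) (by fun_prop))
    (fun _ => Facc_pos _)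

lemma alpha12_pos (μ σ β₁ β₂ : ℝ) : 0 < alpha12 μ σ β₁ β₂ := by
  rw [alpha12_eq]
  simpa using integral_lt_integral_of_forall_lt (integrable_const 0)
    (integrable_Facc_mul_stageTwoRate σ μ β₁ β₂)
    (fun _ => mul_pos (Facc_pos _) (stageTwoRate_pos _ _))

lemma strictAntiOn_alpha12 (μ β₁ β₂ : ℝ) :
    StrictAntiOn (fun σ => alpha12 μ σ β₁ β₂) (Ici 0) := by
  intro σ hσ ρ hρ hlt
  simp only [alpha12_eq]
  exact integral_lt_integral_of_forall_lt (integrable_Facc_mul_stageTwoRate ρ μ β₁ β₂)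
    (integrable_Facc_mul_stageTwoRate σ μ β₁ β₂)
    fun p => mul_lt_mul_of_pos_left (strictAntiOn_stageTwoRate p.2 hσ hρ hlt) (Facc_pos _)

lemma continuous_alpha12 (μ β₁ β₂ : ℝ) : Continuous (fun σ => alpha12 μ σ β₁ β₂) := by
  simp_rw [alpha12_eq]
  exact continuous_of_dominated (bound := fun _ => 1)
    (fun σ => (continuous_Facc_mul_stageTwoRate σ).aestronglyMeasurable)
    (fun σ => .of_forall fun p => norm_Facc_mul_stageTwoRate_le _ _ _) (integrable_const 1)
    (.of_forall fun p => continuous_const.mul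
      (continuous_stageTwoRate.comp (continuous_id.prodMk continuous_const)))

lemma tendsto_alpha12 (μ β₁ β₂ : ℝ) :
    Tendsto (fun σ => alpha12 μ σ β₁ β₂) atTop (𝓝 0) := by
  simp_rw [alpha12_eq]
  rw [← integral_zero (ℝ × ℝ) ℝ (μ := QSmeas μ β₁ β₂)]
  refine tendsto_integral_filter_of_dominated_convergence (fun _ => 1)
    (.of_forall fun σ => (continuous_Facc_mul_stageTwoRate σ).aestronglyMeasurable)
    (.of_forall fun σ => .of_forall fun p => norm_Facc_mul_stageTwoRate_le _ _ _)
    (integrable_const 1) (.of_forall fun p => ?_)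
  simpa using (tendsto_stageTwoRate p.2).const_mul (Facc (p.1 + p.2))

lemma bijOn_Ici_Ioc_of_strictAntiOn {f : ℝ → ℝ} (hanti : StrictAntiOn f (Ici 0))
    (hcont : Continuous f) (hpos : ∀ x, 0 < f x) (hlim : Tendsto f atTop (𝓝 0)) :
    BijOn f (Ici 0) (Ioc 0 (f 0)) := by
  refine ⟨fun x hx => ⟨hpos x, hanti.antitoneOn self_mem_Ici hx hx⟩, hanti.injOn, ?_⟩
  rintro y ⟨hy0, hy⟩
  obtain ⟨b, hb, hb0⟩ := ((hlim.eventually_lt_const hy0).and (eventually_ge_atTop 0)).exists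
  obtain ⟨x, hx, rfl⟩ := intermediate_value_Icc' hb0 hcont.continuousOn ⟨hb.le, hy⟩
  exact ⟨x, hx.1, rfl⟩

/-- for fixed `μ > 0`, `β₂ > 0`, `|β₁| ≤ β₂`, the map
`σ ↦ α_{2|1}(μ, σ) = α₁₂(μ, σ)/α₁(μ)` is a strictly decreasing bijection
from `[0, ∞)` onto `(0, α_{2|1}(μ, 0)]`.  (At `σ = 0` the noise measure
`gaussNoise 0` is the Dirac mass at `0`, i.e. `W_Δ := 0`, so that
`α₁₂(μ, 0) = E[F(Q∞ + S∞)·F(−S∞)]`.) -/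
theorem stmt6 (μ β₁ β₂ : ℝ) (hμ : 0 < μ) (hβ₂ : 0 < β₂) (hβ : |β₁| ≤ β₂) :
    StrictAntiOn (fun σ : ℝ => alpha12 μ σ β₁ β₂ / alpha1 μ β₁ β₂) (Set.Ici 0) ∧
      Set.BijOn (fun σ : ℝ => alpha12 μ σ β₁ β₂ / alpha1 μ β₁ β₂) (Set.Ici 0)
        (Set.Ioc 0 (alpha12 μ 0 β₁ β₂ / alpha1 μ β₁ β₂)) := by
  have hanti : StrictAntiOn (fun σ : ℝ => alpha12 μ σ β₁ β₂ / alpha1 μ β₁ β₂) (Set.Ici 0) :=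
    fun _ hσ _ hρ hlt =>
      div_lt_div_of_pos_right (strictAntiOn_alpha12 μ β₁ β₂ hσ hρ hlt) (alpha1_pos μ β₁ β₂)
  refine ⟨hanti, bijOn_Ici_Ioc_of_strictAntiOn hanti ((continuous_alpha12 μ β₁ β₂).div_const _)
    (fun σ => div_pos (alpha12_pos μ σ β₁ β₂) (alpha1_pos μ β₁ β₂)) ?_⟩
  simpa using (tendsto_alpha12 μ β₁ β₂).div_const (alpha1 μ β₁ β₂)
end

section
/- Let μ > 0, β₂ > 0 and |β₁| < β₂, and let (Q∞, S∞) be a bivariate Gaussian vector with Q∞ ~ N(−μ²/2, μ²), S∞ ~ N(β₁μ²/2, β₂²μ²) and Cov(Q∞, S∞) = −β₁μ², independent of (W*, W) ~ π_{W*} ⊗ π_W. Define A(w) := E[F'(Q∞ + S∞)·F(W* − w − S∞)] and B(w) := E[F(Q∞ + S∞)·F'(W* − w − S∞)], where F(u) := min(1, eᵘ) and F'(u) := eᵘ·1_{u<0}. Then E[A(W)] = E[B(W)] = α₁₂/2, where α₁₂ := E[F(Q∞ + S∞)·F(W* − W − S∞)]. -/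
open MeasureTheory ProbabilityTheory Real Filter Set
open scoped Topology

/-- `F'(u) = eᵘ·1_{u<0}`. -/
noncomputable def Fd (u : ℝ) : ℝ := if u < 0 then Real.exp u else 0

/-- The proposal-noise measure with density `π_{W*}`. -/
noncomputable def Mstar (wstar : ℝ → ℝ) : Measure ℝ :=
  volume.withDensity fun w => ENNReal.ofReal (wstar w)

/-- The stationary-noise measure with density `π_W(w) = e^w π_{W*}(w)`. -/
noncomputable def MW (wstar : ℝ → ℝ) : Measure ℝ :=
  volume.withDensity fun w => ENNReal.ofReal (Real.exp w * wstar w)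

/-- `A(w) = E[F'(Q∞ + S∞)·F(W* − w − S∞)]`. -/
noncomputable def Afun (μ β₁ β₂ : ℝ) (wstar : ℝ → ℝ) (w : ℝ) : ℝ :=
  ∫ p : (ℝ × ℝ) × ℝ, Fd (p.1.1 + p.1.2) * Facc (p.2 - w - p.1.2)
    ∂((QSmeas μ β₁ β₂).prod (Mstar wstar))

/-- `B(w) = E[F(Q∞ + S∞)·F'(W* − w − S∞)]`. -/
noncomputable def Bfun (μ β₁ β₂ : ℝ) (wstar : ℝ → ℝ) (w : ℝ) : ℝ :=
  ∫ p : (ℝ × ℝ) × ℝ, Facc (p.1.1 + p.1.2) * Fd (p.2 - w - p.1.2)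
    ∂((QSmeas μ β₁ β₂).prod (Mstar wstar))

/-- `α₁₂ = E[F(Q∞ + S∞)·F(W* − W − S∞)]` for `(W*, W) ~ π_{W*} ⊗ π_W`. -/
noncomputable def alpha12gen (μ β₁ β₂ : ℝ) (wstar : ℝ → ℝ) : ℝ :=
  ∫ p : (ℝ × ℝ) × (ℝ × ℝ), Facc (p.1.1 + p.1.2) * Facc (p.2.1 - p.2.2 - p.1.2)
    ∂((QSmeas μ β₁ β₂).prod ((Mstar wstar).prod (MW wstar)))

/-- A density pulls back along a map. -/
lemma withDensity_map_eq_map_withDensity {α β : Type*} [MeasurableSpace α] [MeasurableSpace β]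
    (ν : Measure α) {f : α → β} (hf : Measurable f) {ρ : β → ENNReal} (hρ : Measurable ρ) :
    (ν.map f).withDensity ρ = (ν.withDensity (fun x => ρ (f x))).map f := by
  ext t ht
  rw [withDensity_apply _ ht, setLIntegral_map ht hρ hf, Measure.map_apply hf ht,
    withDensity_apply _ (hf ht)]

/-- Exponential tilting of a standard Gaussian shifts its mean. -/
lemma gaussianReal_withDensity_exp (m : ℝ) :
    (gaussianReal 0 1).withDensity (fun x => ENNReal.ofReal (exp (-m ^ 2 / 2 + m * x))) =
      gaussianReal m 1 := by
  rw [gaussianReal_of_var_ne_zero _ one_ne_zero, gaussianReal_of_var_ne_zero _ one_ne_zero,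
    ← withDensity_mul _ (measurable_gaussianPDF _ _) (by fun_prop)]
  congr 1
  ext x
  simp only [Pi.mul_apply, gaussianPDF]
  rw [← ENNReal.ofReal_mul (gaussianPDFReal_nonneg _ _ _)]
  congr 1
  simp only [gaussianPDFReal]
  rw [mul_assoc, ← exp_add]
  congr 2
  simp only [NNReal.coe_one]
  ring

/-- The reflection symmetry of the law of `(Q∞, S∞)` under tilting by `e^{Q∞}`. -/
lemma QSmeas_flip (μ β₁ β₂ : ℝ) :
    ((QSmeas μ β₁ β₂).withDensity (fun p => ENNReal.ofReal (exp p.1))).map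
      (fun p => (-p.1, -p.2)) = QSmeas μ β₁ β₂ := by
  have hfst : ((gaussianReal 0 1).withDensity
      (fun x => ENNReal.ofReal (exp (-μ ^ 2 / 2 + μ * x)))).map (fun x => μ - x) =
        gaussianReal 0 1 := by
    rw [gaussianReal_withDensity_exp, gaussianReal_map_const_sub, sub_self]
  have hsnd : (gaussianReal 0 1).map (fun x => -x) = gaussianReal 0 1 := by
    rw [gaussianReal_map_neg, neg_zero]
  have hprod : (((gaussianReal 0 1).withDensity
      (fun x => ENNReal.ofReal (exp (-μ ^ 2 / 2 + μ * x)))).prod (gaussianReal 0 1)).map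
        (Prod.map (fun x => μ - x) (fun x => -x)) =
      (gaussianReal 0 1).prod (gaussianReal 0 1) := by
    rw [← Measure.map_prod_map _ _ (by fun_prop) (by fun_prop), hfst, hsnd]
  unfold QSmeas
  rw [withDensity_map_eq_map_withDensity _ (by fun_prop) (by fun_prop),
    Measure.map_map (by fun_prop) (by fun_prop)]
  conv_rhs => rw [← hprod]
  rw [Measure.map_map (by fun_prop) (by fun_prop), prod_withDensity_left (by fun_prop)]
  congr 1
  ext z <;> simp only [Function.comp_apply, Prod.map_fst, Prod.map_snd] <;> ring

/-- `Q∞ + S∞` has no atom at the origin. -/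
lemma ae_QSmeas_add_ne_zero {μ β₁ β₂ : ℝ} (hμ : 0 < μ) (hβ : |β₁| < β₂) :
    ∀ᵐ p ∂(QSmeas μ β₁ β₂), p.1 + p.2 ≠ 0 := by
  have hs : 0 < √(β₂ ^ 2 - β₁ ^ 2) := by
    exact Real.sqrt_pos.2 (sub_pos.2 (sq_lt_sq.2 (hβ.trans_le (le_abs_self _))))
  have hmeas : MeasurableSet {p : ℝ × ℝ | p.1 + p.2 ≠ 0} :=
    (measurableSet_eq_fun (by fun_prop) measurable_const).compl
  have : NullSingletonClass (gaussianReal 0 1) := nullSingletonClass_gaussianReal one_ne_zero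
  unfold QSmeas
  rw [ae_map_iff (by fun_prop) hmeas]
  have hmeas' : MeasurableSet {z : ℝ × ℝ | (-μ ^ 2 / 2 + μ * z.1) +
      (β₁ * μ ^ 2 / 2 + μ * (-(β₁ * z.1) + √(β₂ ^ 2 - β₁ ^ 2) * z.2)) ≠ 0} :=
    (measurableSet_eq_fun (by fun_prop) measurable_const).compl
  rw [Measure.ae_prod_iff_ae_ae hmeas']
  refine Eventually.of_forall fun x => ?_
  have hne := Measure.ae_ne (gaussianReal 0 1)
    (-((-μ ^ 2 / 2 + μ * x) + (β₁ * μ ^ 2 / 2 + μ * (-(β₁ * x)))) / (μ * √(β₂ ^ 2 - β₁ ^ 2)))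
  filter_upwards [hne] with y hy h
  apply hy
  rw [eq_div_iff (by positivity)]
  linear_combination h

/-- The exchange symmetry of `(W*, W)` under tilting by `e^{W* - W}`. -/
lemma noise_flip {wstar : ℝ → ℝ} (hmeas : Measurable wstar) :
    (((Mstar wstar).prod (MW wstar)).withDensity
      (fun p => ENNReal.ofReal (exp (p.1 - p.2)))).map Prod.swap =
        (Mstar wstar).prod (MW wstar) := by
  unfold Mstar MW
  rw [prod_withDensity (by fun_prop) (by fun_prop)]
  conv_rhs => rw [← Measure.prod_swap]
  rw [withDensity_map_eq_map_withDensity _ measurable_swap (by fun_prop),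
    ← withDensity_mul _ (by fun_prop) (by fun_prop)]
  congr 2
  ext p
  simp only [Pi.mul_apply, Prod.fst_swap, Prod.snd_swap]
  rw [ENNReal.ofReal_mul (exp_pos _).le, ENNReal.ofReal_mul (exp_pos _).le]
  have h : ENNReal.ofReal (exp p.1) =
      ENNReal.ofReal (exp p.2) * ENNReal.ofReal (exp (p.1 - p.2)) := by
    rw [← ENNReal.ofReal_mul (exp_pos _).le, ← exp_add]
    congr 2
    ring
  rw [h]
  ring

/-- `W* - W - S∞` has no atom at the origin, as the noise has a density. -/
lemma ae_noise_sub_ne_zero (wstar : ℝ → ℝ) (ν : Measure (ℝ × ℝ)) [SFinite ν] :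
    ∀ᵐ p ∂(ν.prod ((Mstar wstar).prod (MW wstar))), p.2.1 - p.2.2 - p.1.2 ≠ 0 := by
  have : SFinite (Mstar wstar) := by unfold Mstar; infer_instance
  have : SFinite (MW wstar) := by unfold MW; infer_instance
  have : NullSingletonClass (MW wstar) := by unfold MW; infer_instance
  have h1 : MeasurableSet {p : (ℝ × ℝ) × (ℝ × ℝ) | p.2.1 - p.2.2 - p.1.2 ≠ 0} :=
    (measurableSet_eq_fun (by fun_prop) measurable_const).compl
  have h2 (s : ℝ) : MeasurableSet {p : ℝ × ℝ | p.1 - p.2 - s ≠ 0} :=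
    (measurableSet_eq_fun (by fun_prop) measurable_const).compl
  rw [Measure.ae_prod_iff_ae_ae h1]
  refine Eventually.of_forall fun x => ?_
  rw [Measure.ae_prod_iff_ae_ae (h2 x.2)]
  refine Eventually.of_forall fun a => ?_
  filter_upwards [Measure.ae_ne (MW wstar) (a - x.2)] with b hb h
  exact hb (by linear_combination -h)

@[fun_prop]
lemma measurable_Facc : Measurable Facc := by
  unfold Facc
  fun_prop

@[fun_prop]
lemma measurable_Fd : Measurable Fd :=
  Measurable.ite measurableSet_Iio measurable_exp measurable_const

lemma abs_Facc_le_one (u : ℝ) : |Facc u| ≤ 1 := by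
  unfold Facc
  rw [abs_of_nonneg (le_min zero_le_one (exp_pos u).le)]
  exact min_le_left _ _

lemma abs_Fd_le_one (u : ℝ) : |Fd u| ≤ 1 := by
  unfold Fd
  split_ifs with h
  · rw [abs_of_pos (exp_pos u)]
    exact exp_le_one_iff.2 h.le
  · simp

lemma exp_mul_Facc_neg (u : ℝ) : exp u * Facc (-u) = Facc u := by
  unfold Facc
  rw [mul_min_of_nonneg _ _ (exp_pos u).le, ← exp_add, add_neg_cancel, exp_zero, mul_one, min_comm]

lemma Fd_add_exp_mul_Fd_neg {u : ℝ} (hu : u ≠ 0) : Fd u + exp u * Fd (-u) = Facc u := by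
  unfold Fd Facc
  rcases hu.lt_or_gt with h | h
  · rw [if_pos h, if_neg (by linarith), min_eq_right (exp_le_one_iff.2 h.le)]
    ring
  · rw [if_neg (by linarith), if_pos (by linarith), min_eq_left (one_le_exp h.le), ← exp_add]
    simp

lemma integrable_Fd_mul_Facc {Ω : Type*} [MeasurableSpace Ω] (ν : Measure Ω) [IsFiniteMeasure ν]
    {u v : Ω → ℝ} (hu : Measurable u) (hv : Measurable v) :
    Integrable (fun x => Fd (u x) * Facc (v x)) ν := by
  refine Integrable.of_bound (by fun_prop) 1 (Eventually.of_forall fun x => ?_)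
  rw [norm_mul]
  exact mul_le_one₀ (abs_Fd_le_one _) (norm_nonneg _) (abs_Facc_le_one _)

lemma integrable_Facc_mul_Facc {Ω : Type*} [MeasurableSpace Ω] (ν : Measure Ω)
    [IsFiniteMeasure ν] {u v : Ω → ℝ} (hu : Measurable u) (hv : Measurable v) :
    Integrable (fun x => Facc (u x) * Facc (v x)) ν := by
  refine Integrable.of_bound (by fun_prop) 1 (Eventually.of_forall fun x => ?_)
  rw [norm_mul]
  exact mul_le_one₀ (abs_Facc_le_one _) (norm_nonneg _) (abs_Facc_le_one _)

/-- If `σ` reverses the signs of `u` and `v` and preserves `ν` up to tilting by `e^{u + v}`, then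
`F'(u) F(v)` carries exactly half of the integral of `F(u) F(v)`. -/
lemma integral_Fd_mul_Facc_eq_half {Ω : Type*} [MeasurableSpace Ω] (ν : Measure Ω)
    [IsFiniteMeasure ν] {u v : Ω → ℝ} (hu : Measurable u) (hv : Measurable v)
    {σ : Ω → Ω} (hσ : Measurable σ) (huσ : ∀ x, u (σ x) = -u x) (hvσ : ∀ x, v (σ x) = -v x)
    (hflip : (ν.withDensity (fun x => ENNReal.ofReal (exp (u x + v x)))).map σ = ν)
    (hne : ∀ᵐ x ∂ν, u x ≠ 0) :
    ∫ x, Fd (u x) * Facc (v x) ∂ν = (∫ x, Facc (u x) * Facc (v x) ∂ν) / 2 := by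
  have hreflect : ∫ x, Fd (u x) * Facc (v x) ∂ν =
      ∫ x, Facc (u x) * Facc (v x) - Fd (u x) * Facc (v x) ∂ν := by
    conv_lhs => rw [← hflip]
    rw [integral_map hσ.aemeasurable (by fun_prop),
      integral_withDensity_eq_integral_toReal_smul (by fun_prop)
        (Eventually.of_forall fun _ => ENNReal.ofReal_lt_top)]
    refine integral_congr_ae ?_
    filter_upwards [hne] with x hx
    rw [ENNReal.toReal_ofReal (exp_pos _).le, huσ, hvσ, smul_eq_mul, exp_add,
      ← Fd_add_exp_mul_Fd_neg hx, ← exp_mul_Facc_neg (v x)]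
    ring
  rw [integral_sub (integrable_Facc_mul_Facc ν hu hv) (integrable_Fd_mul_Facc ν hu hv)]
    at hreflect
  linarith

/-- The joint reflection symmetry of `((Q∞, S∞), (W*, W))`. -/
lemma joint_flip (μ β₁ β₂ : ℝ) {wstar : ℝ → ℝ} (hmeas : Measurable wstar) :
    (((QSmeas μ β₁ β₂).prod ((Mstar wstar).prod (MW wstar))).withDensity
      (fun p => ENNReal.ofReal (exp (p.1.1 + (p.2.1 - p.2.2))))).map
        (Prod.map (fun p => (-p.1, -p.2)) Prod.swap) =
      (QSmeas μ β₁ β₂).prod ((Mstar wstar).prod (MW wstar)) := by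
  have : SFinite (Mstar wstar) := by unfold Mstar; infer_instance
  have : SFinite (MW wstar) := by unfold MW; infer_instance
  conv_rhs => rw [← QSmeas_flip μ β₁ β₂, ← noise_flip hmeas]
  rw [Measure.map_prod_map _ _ (by fun_prop) measurable_swap,
    prod_withDensity (by fun_prop) (by fun_prop)]
  congr 2
  ext p
  rw [exp_add, ENNReal.ofReal_mul (exp_pos _).le]

/-- Regrouping an iterated integral over `((Q∞, S∞), W*)` and `W`. -/
lemma integral_integral_prod_assoc {α β γ : Type*} [MeasurableSpace α] [MeasurableSpace β]
    [MeasurableSpace γ] (P : Measure α) (M : Measure β) (N : Measure γ) [SFinite P] [SFinite M]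
    [SFinite N] {f : α × (β × γ) → ℝ} (hf : Integrable f (P.prod (M.prod N))) :
    ∫ w, ∫ p, f (p.1, (p.2, w)) ∂(P.prod M) ∂N = ∫ x, f x ∂(P.prod (M.prod N)) := by
  have hassoc := measurePreserving_prodAssoc P M N
  rw [← hassoc.integral_comp', integral_prod_symm]
  · rfl
  · exact (hassoc.integrable_comp_emb (MeasurableEquiv.measurableEmbedding _)).2 hf

/-- for general noise `π_{W*}` with `∫ e^w π_{W*}(w) dw = 1` and
`π_W(w) = e^w π_{W*}(w)`, one has `E[A(W)] = E[B(W)] = α₁₂/2`. -/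
theorem stmt10 (μ β₁ β₂ : ℝ) (hμ : 0 < μ) (hβ₂ : 0 < β₂) (hβ : |β₁| < β₂)
    (wstar : ℝ → ℝ) (hmeas : Measurable wstar) (hnonneg : ∀ w, 0 ≤ wstar w)
    (hint : ∫ w : ℝ, wstar w = 1) (hexp : ∫ w : ℝ, Real.exp w * wstar w = 1) :
    (∫ w : ℝ, Afun μ β₁ β₂ wstar w ∂(MW wstar)) = alpha12gen μ β₁ β₂ wstar / 2 ∧
      (∫ w : ℝ, Bfun μ β₁ β₂ wstar w ∂(MW wstar)) = alpha12gen μ β₁ β₂ wstar / 2 := by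
  have hfin : IsFiniteMeasure (Mstar wstar) :=
    isFiniteMeasure_withDensity_ofReal (integrable_of_integral_eq_one hint).2
  have hfin' : IsFiniteMeasure (MW wstar) :=
    isFiniteMeasure_withDensity_ofReal (integrable_of_integral_eq_one hexp).2
  let T := (QSmeas μ β₁ β₂).prod ((Mstar wstar).prod (MW wstar))
  let u : (ℝ × ℝ) × (ℝ × ℝ) → ℝ := fun p => p.1.1 + p.1.2
  let v : (ℝ × ℝ) × (ℝ × ℝ) → ℝ := fun p => p.2.1 - p.2.2 - p.1.2
  let σ : (ℝ × ℝ) × (ℝ × ℝ) → (ℝ × ℝ) × (ℝ × ℝ) := Prod.map (fun p => (-p.1, -p.2)) Prod.swap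
  have hu : Measurable u := by fun_prop
  have hv : Measurable v := by fun_prop
  have hσ : Measurable σ := Measurable.prodMap (by fun_prop) measurable_swap
  have huσ : ∀ x, u (σ x) = -u x := fun x => by
    simp only [u, σ, Prod.map_fst]; ring
  have hvσ : ∀ x, v (σ x) = -v x := fun x => by
    simp only [v, σ, Prod.map_fst, Prod.map_snd, Prod.fst_swap, Prod.snd_swap]; ring
  have hflip : (T.withDensity (fun x => ENNReal.ofReal (exp (u x + v x)))).map σ = T := by
    have huv : ∀ x, u x + v x = x.1.1 + (x.2.1 - x.2.2) := fun x => by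
      simp only [u, v]; ring
    simp only [huv]
    exact joint_flip μ β₁ β₂ hmeas
  have hflip' : (T.withDensity (fun x => ENNReal.ofReal (exp (v x + u x)))).map σ = T := by
    simpa only [add_comm] using hflip
  have hu0 : ∀ᵐ x ∂T, u x ≠ 0 :=
    Measure.quasiMeasurePreserving_fst.ae (ae_QSmeas_add_ne_zero hμ hβ)
  have hv0 : ∀ᵐ x ∂T, v x ≠ 0 := ae_noise_sub_ne_zero wstar _
  constructor
  · exact (integral_integral_prod_assoc _ _ _ (integrable_Fd_mul_Facc T hu hv)).trans
      (integral_Fd_mul_Facc_eq_half T hu hv hσ huσ hvσ hflip hu0)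
  · have hB := (integral_integral_prod_assoc _ _ _ (integrable_Fd_mul_Facc T hv hu)).trans
      (integral_Fd_mul_Facc_eq_half T hv hu hσ hvσ huσ hflip' hv0)
    simp only [mul_comm (Fd (v _)), mul_comm (Facc (v _))] at hB
    exact hB
end

section
/- Let W* ~ π_{W*} and W ~ π_W be independent and set R := W* − W, whose density is π_R(r) = ∫ π_{W*}(w + r) π_W(w) dw. Then for (Lebesgue-almost) every r ∈ ℝ, e^{r/2} π_R(r) = e^{−r/2} π_R(−r); that is, the function r ↦ e^{r/2} π_R(r) is even. -/
open MeasureTheory ProbabilityTheory Real Filter Set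
open scoped Topology

/-- let `π_{W*}` be a probability density on `ℝ` with `∫ e^w π_{W*}(w) dw = 1`
and `π_W(w) := e^w π_{W*}(w)`.  If `W* ~ π_{W*}` and `W ~ π_W` are independent and
`R := W* − W` has density `π_R(r) = ∫ π_{W*}(w + r) π_W(w) dw`, then for Lebesgue-a.e.
`r ∈ ℝ`, `e^{r/2} π_R(r) = e^{−r/2} π_R(−r)`, i.e. `r ↦ e^{r/2} π_R(r)` is even. -/
theorem stmt11 (wstar : ℝ → ℝ) (hmeas : Measurable wstar) (hnonneg : ∀ w, 0 ≤ wstar w)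
    (hint : ∫ w : ℝ, wstar w = 1) (hexp : ∫ w : ℝ, Real.exp w * wstar w = 1) :
    ∀ᵐ r : ℝ ∂(volume : Measure ℝ),
      Real.exp (r / 2) * (∫ w : ℝ, wstar (w + r) * (Real.exp w * wstar w)) =
        Real.exp (-r / 2) * (∫ w : ℝ, wstar (w + -r) * (Real.exp w * wstar w)) := by
  refine Eventually.of_forall fun r => ?_
  rw [← integral_add_right_eq_self (fun w : ℝ => wstar (w + -r) * (Real.exp w * wstar w)) r,
    ← integral_const_mul, ← integral_const_mul]
  congr 1 with w
  have h : Real.exp (r / 2) = Real.exp (-r / 2) * Real.exp r := by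
    rw [← Real.exp_add]
    ring_nf
  rw [add_neg_cancel_right, Real.exp_add, h]
  ring
end

section
/- Let μ > 0, β₂ > 0 and |β₁| < β₂, and let π_{Q,S} denote the joint Lebesgue density of the (nondegenerate) bivariate Gaussian vector (Q∞, S∞) with Q∞ ~ N(−μ²/2, μ²), S∞ ~ N(β₁μ²/2, β₂²μ²) and Cov(Q∞, S∞) = −β₁μ². Then for all (q, s) ∈ ℝ², e^{q/2} π_{Q,S}(q, s) = e^{−q/2} π_{Q,S}(−q, −s). -/
open MeasureTheory ProbabilityTheory Real Filter Set
open scoped Topology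

/-- The joint Lebesgue density `π_{Q,S}` of the bivariate Gaussian vector `(Q∞, S∞)` with
mean vector `(−μ²/2, β₁μ²/2)` and covariance matrix `[[μ², −β₁μ²], [−β₁μ², β₂²μ²]]`
(invertible when `|β₁| < β₂`; its determinant is `μ⁴(β₂² − β₁²)` and its inverse is
`(1/det)·[[β₂²μ², β₁μ²], [β₁μ², μ²]]`). -/
noncomputable def piQS (μ β₁ β₂ q s : ℝ) : ℝ :=
  (1 / (2 * Real.pi * Real.sqrt (μ ^ 4 * (β₂ ^ 2 - β₁ ^ 2)))) *
    Real.exp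
      (-(β₂ ^ 2 * μ ^ 2 * (q + μ ^ 2 / 2) ^ 2 +
            2 * β₁ * μ ^ 2 * (q + μ ^ 2 / 2) * (s - β₁ * μ ^ 2 / 2) +
            μ ^ 2 * (s - β₁ * μ ^ 2 / 2) ^ 2) /
        (2 * (μ ^ 4 * (β₂ ^ 2 - β₁ ^ 2))))

/-- for `μ > 0`, `β₂ > 0` and `|β₁| < β₂`, the joint density `π_{Q,S}` of
`(Q∞, S∞)` satisfies `e^{q/2} π_{Q,S}(q, s) = e^{−q/2} π_{Q,S}(−q, −s)` for all `(q, s)`. -/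
theorem stmt12 (μ β₁ β₂ : ℝ) (hμ : 0 < μ) (hβ₂ : 0 < β₂) (hβ : |β₁| < β₂) :
    ∀ q s : ℝ,
      Real.exp (q / 2) * piQS μ β₁ β₂ q s = Real.exp (-q / 2) * piQS μ β₁ β₂ (-q) (-s) := by
  intro q s
  have hβ_pos : 0 < β₂ ^ 2 - β₁ ^ 2 := sub_pos.mpr (sq_lt_sq.mpr (hβ.trans_le (le_abs_self β₂)))
  unfold piQS
  rw [mul_left_comm, ← Real.exp_add, mul_left_comm (Real.exp (-q / 2)), ← Real.exp_add]
  congr 2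
  field_simp
  ring
end
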